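/- Let S = {x_1, ..., x_n} be a meet closed set of n distinct elements of P and let g : P → ℂ be any function. Then the determinant of the meet matrix (S)_g equals the product over k = 1, ..., n of the sums Σ_{z ∈ S, z ≤ x_k} g(z) · μ_S(z, x_k). -/

import Mathlib

open scoped Classical

/-- The Möbius function of the finite subposet determined by a finite subset `S` of `P`
(the inverse of the zeta function in the incidence algebra of `S`), extended by `0`
outside `S × S`. -/
noncomputable def mobiusS {P : Type*} [Lattice P] (S : Finset P) (a b : P) : ℂ :=
  letI : LocallyFiniteOrder ↥S := Fintype.toLocallyFiniteOrder
  if ha : a ∈ S then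
    if hb : b ∈ S then IncidenceAlgebra.mu ℂ (⟨a, ha⟩ : ↥S) (⟨b, hb⟩ : ↥S) else 0
  else 0

lemma mobiusS_of_not_le {P : Type*} [Lattice P] (S : Finset P) (a b : P) (h : ¬ a ≤ b) :
    mobiusS S a b = 0 := by
  unfold mobiusS
  split_ifs with ha hb
  · exact IncidenceAlgebra.apply_eq_zero_of_not_le (by simpa using h) _
  · rfl
  · rfl

lemma sum_mobiusS {P : Type*} [Lattice P] (S : Finset P) (a b : P) (ha : a ∈ S) (hb : b ∈ S) :
    ∑ k ∈ S, (if k ≤ b then mobiusS S a k else 0) = if a = b then 1 else 0 := by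
  letI : LocallyFiniteOrder ↥S := Fintype.toLocallyFiniteOrder
  have h := IncidenceAlgebra.sum_Icc_mu_right (𝕜 := ℂ) (⟨a, ha⟩ : ↥S) (⟨b, hb⟩ : ↥S)
  simp only [Subtype.mk.injEq] at h
  rw [← h, ← Finset.sum_coe_sort S]
  symm
  apply Finset.sum_subset_zero_on_sdiff (Finset.subset_univ _)
  · intro k hk
    simp only [Finset.mem_sdiff, Finset.mem_univ, true_and, Finset.mem_Icc, not_and] at hk
    split_ifs with hkb
    · apply mobiusS_of_not_le
      intro hak
      exact hk hak hkb
    · rfl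
  · intro k hk
    rw [Finset.mem_Icc] at hk
    have hkb : (k : P) ≤ b := hk.2
    rw [if_pos hkb]
    unfold mobiusS
    rw [dif_pos ha, dif_pos k.2]

/-- For a meet closed set `S = {x_1, …, x_n}` of distinct elements of a lattice `P`
with finite principal order ideals, indexed so that `x_i < x_j → i < j`, and any `g : P → ℂ`,
the determinant of the meet matrix `(S)_g` equals
`∏_{k} Σ_{z ∈ S, z ≤ x_k} g(z) · μ_S(z, x_k)`. -/
theorem det_meetMatrix_eq_prod
    {P : Type*} [Lattice P] (hfin : ∀ p : P, {y : P | y ≤ p}.Finite)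
    {n : ℕ} (x : Fin n → P) (hinj : Function.Injective x)
    (hidx : ∀ i j : Fin n, x i < x j → i < j)
    (hmeet : ∀ i j : Fin n, ∃ k : Fin n, x k = x i ⊓ x j)
    (g : P → ℂ) :
    (Matrix.of fun i j : Fin n => g (x i ⊓ x j)).det =
      ∏ k : Fin n,
        ∑ i ∈ Finset.univ.filter (fun i : Fin n => x i ≤ x k),
          g (x i) * mobiusS (Finset.image x Finset.univ) (x i) (x k) := by
  set S := Finset.image x Finset.univ with hS
  have hmem : ∀ i, x i ∈ S := fun i => Finset.mem_image_of_mem x (Finset.mem_univ i)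
  set f : Fin n → ℂ := fun k => ∑ i ∈ Finset.univ.filter (fun i : Fin n => x i ≤ x k),
          g (x i) * mobiusS S (x i) (x k) with hf
  have hf' : ∀ k, f k = ∑ i, g (x i) * mobiusS S (x i) (x k) := by
    intro k
    simp only [hf]
    apply Finset.sum_subset (Finset.subset_univ _)
    intro i _ hi
    rw [mobiusS_of_not_le _ _ _ (by simpa using hi), mul_zero]
  have key : ∀ b, ∑ k, (if x k ≤ x b then f k else 0) = g (x b) := by
    intro b
    have h1 : ∀ i, ∑ k, (if x k ≤ x b then mobiusS S (x i) (x k) else 0)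
        = if i = b then 1 else 0 := by
      intro i
      have := sum_mobiusS S (x i) (x b) (hmem i) (hmem b)
      rw [hS, Finset.sum_image (fun _ _ _ _ h => hinj h)] at this
      simpa [hinj.eq_iff] using this
    calc ∑ k, (if x k ≤ x b then f k else 0)
        = ∑ k, ∑ i, g (x i) * (if x k ≤ x b then mobiusS S (x i) (x k) else 0) := by
          refine Finset.sum_congr rfl fun k _ => ?_
          rw [hf']
          split_ifs <;> simp
      _ = ∑ i, g (x i) * (if i = b then 1 else 0) := by
          rw [Finset.sum_comm]
          refine Finset.sum_congr rfl fun i _ => ?_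
          rw [← Finset.mul_sum, h1]
      _ = g (x b) := by simp
  let E : Matrix (Fin n) (Fin n) ℂ := Matrix.of fun i k => if x k ≤ x i then 1 else 0
  have hE : E.det = 1 := by
    rw [Matrix.det_of_lowerTriangular]
    · simp [E]
    · intro i k hik
      have hik' : i < k := hik
      simp only [E, Matrix.of_apply]
      rw [if_neg]
      intro hle
      have hlt : x k < x i := lt_of_le_of_ne hle fun h => hik'.ne' (hinj h)
      exact absurd (hidx _ _ hlt) hik'.asymm
  have hM : (Matrix.of fun i j : Fin n => g (x i ⊓ x j)) = E * Matrix.diagonal f * E.transpose := by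
    ext i j
    obtain ⟨b, hb⟩ := hmeet i j
    rw [Matrix.mul_apply]
    simp only [Matrix.of_apply, Matrix.mul_diagonal, Matrix.transpose_apply, E]
    rw [← hb, ← key b]
    refine Finset.sum_congr rfl fun k _ => ?_
    rw [hb]
    by_cases h1 : x k ≤ x i <;> by_cases h2 : x k ≤ x j <;> simp [h1, h2]
  rw [hM, Matrix.det_mul, Matrix.det_mul, Matrix.det_transpose, hE, Matrix.det_diagonal]
  simp
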